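/- Let n ≡ 2 (mod 3) and let T ⊆ ℤ^n be a perfect Lee code of radius 1 with 0 ∈ T. Then T contains no codeword of type [4^1] (a word ±4e_i) and no codeword of type [2^2] (two coordinates ±2, rest 0), and the number of codewords of type [3^1,1^1] (one coordinate ±3, another ±1, rest 0) equals 2n. -/

import Mathlib

/-- `T ⊆ ℤ^n` is a perfect Lee code of radius 1. -/
def PerfectLeeCode (n : ℕ) (T : Set (Fin n → ℤ)) : Prop :=
  ∀ x : Fin n → ℤ, ∃! t, t ∈ T ∧ ∑ i, |x i - t i| ≤ 1

/-- Type [4^1]: one coordinate equal to ±4, the rest 0. -/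
def IsType41 {n : ℕ} (W : Fin n → ℤ) : Prop :=
  ∃ i, |W i| = 4 ∧ ∀ k, k ≠ i → W k = 0

/-- Type [2^2]: two coordinates equal to ±2, the rest 0. -/
def IsType22 {n : ℕ} (W : Fin n → ℤ) : Prop :=
  ∃ i j, i ≠ j ∧ |W i| = 2 ∧ |W j| = 2 ∧ ∀ k, k ≠ i → k ≠ j → W k = 0

/-- Type [3^1,1^1]: one coordinate ±3, one other coordinate ±1, the rest 0. -/
def IsType3111 {n : ℕ} (W : Fin n → ℤ) : Prop :=
  ∃ i j, i ≠ j ∧ |W i| = 3 ∧ |W j| = 1 ∧ ∀ k, k ≠ i → k ≠ j → W k = 0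

section Dilation

open Finset

variable {G ι : Type*} [AddCommGroup G] [Fintype ι]

/-- The action of `G` on functions `G → R` by translation. -/
def translationEnd (R G : Type*) [CommSemiring R] [AddCommGroup G] :
    Multiplicative G →* Module.End R (G → R) where
  toFun g :=
    { toFun := fun f x => f (x - g.toAdd)
      map_add' := fun _ _ => rfl
      map_smul' := fun _ _ => rfl }
  map_one' := by ext; simp
  map_mul' g h := by
    refine LinearMap.ext fun f => funext fun x => ?_
    simp [sub_sub]

lemma translationEnd_apply {R : Type*} [CommSemiring R] (g : G) (f : G → R) (x : G) :
    translationEnd R G (Multiplicative.ofAdd g) f x = f (x - g) := rfl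

/-- Modulo `p`, the `p`-fold convolution power of a finite family is its `p`-fold dilate. -/
lemma pow_sum_translationEnd (p : ℕ) [Fact p.Prime] (a : ι → G) :
    (∑ i, translationEnd (ZMod p) G (Multiplicative.ofAdd (a i))) ^ p =
      ∑ i, translationEnd (ZMod p) G (Multiplicative.ofAdd (p • a i)) := by
  let φ := AddMonoidAlgebra.lift (ZMod p) (Module.End (ZMod p) (G → ZMod p)) G
    (translationEnd (ZMod p) G)
  have hφ (g : G) : φ (AddMonoidAlgebra.single g 1) =
      translationEnd (ZMod p) G (Multiplicative.ofAdd g) := by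
    simp [φ]
  have key : (∑ i, AddMonoidAlgebra.single (a i) (1 : ZMod p)) ^ p =
      ∑ i, AddMonoidAlgebra.single (p • a i) (1 : ZMod p) := by
    have : CharP (AddMonoidAlgebra (ZMod p) G) p :=
      charP_of_injective_algebraMap (algebraMap (ZMod p) (AddMonoidAlgebra (ZMod p) G)).injective p
    rw [sum_pow_char p]
    simp [AddMonoidAlgebra.single_pow]
  simpa only [map_pow, map_sum, hφ] using congrArg φ key

/-- If the translates of a finite family `a` by a weight `χ` tile `G`, then so do those of its
dilate by a prime not dividing the number of members of the family. -/
theorem sum_sub_nsmul_eq_one {p : ℕ} [Fact p.Prime] {a : ι → G} {χ : G → ℕ}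
    (hp : ¬p ∣ Fintype.card ι) (h : ∀ x, ∑ i, χ (x - a i) = 1) (x : G) :
    ∑ i, χ (x - p • a i) = 1 := by
  have hp0 : (Fintype.card ι : ZMod p) ≠ 0 := by rwa [Ne, ZMod.natCast_eq_zero_iff]
  set S := ∑ i, translationEnd (ZMod p) G (Multiplicative.ofAdd (a i)) with hS
  have hconst (c : ZMod p) : S (fun _ => c) = fun _ => Fintype.card ι * c := by
    funext y
    simp [hS, LinearMap.sum_apply, Finset.sum_apply, translationEnd_apply]
  have hχ : S (fun y => (χ y : ZMod p)) = fun _ => 1 := by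
    funext y
    simp only [hS, LinearMap.sum_apply, Finset.sum_apply, translationEnd_apply]
    exact_mod_cast congrArg (Nat.cast : ℕ → ZMod p) (h y)
  have hpow (k : ℕ) : (S ^ (k + 1)) (fun y => (χ y : ZMod p)) =
      fun _ => (Fintype.card ι : ZMod p) ^ k := by
    induction k with
    | zero => simpa using hχ
    | succ k ih => rw [pow_succ', Module.End.mul_apply, ih, hconst, pow_succ']
  have hmod (y : G) : ((∑ i, χ (y - p • a i) : ℕ) : ZMod p) = 1 := by
    have h1 := hpow (p - 1)
    rw [Nat.sub_add_cancel (Fact.out : p.Prime).one_le, hS, pow_sum_translationEnd,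
      ZMod.pow_card_sub_one_eq_one hp0] at h1
    have h2 := congrFun h1 y
    simp only [LinearMap.sum_apply, Finset.sum_apply, translationEnd_apply] at h2
    exact_mod_cast h2
  have hpos (y : G) : 1 ≤ ∑ i, χ (y - p • a i) := by
    refine Nat.one_le_iff_ne_zero.2 fun h1 => ?_
    have h2 := hmod y
    rw [h1] at h2
    simp at h2
  obtain ⟨b⟩ : Nonempty ι := by
    by_contra hne
    rw [not_nonempty_iff] at hne
    simp at hp
  have htotal : ∑ _j : ι, 1 = ∑ j, ∑ i, χ (x + a b - a j - p • a i) := by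
    rw [Finset.sum_comm]
    refine Finset.sum_congr rfl fun i _ => ?_
    rw [← h (x + a b - p • a i)]
    exact Finset.sum_congr rfl fun j _ => by rw [sub_right_comm]
  have := (Finset.sum_eq_sum_iff_of_le fun j _ => hpos (x + a b - a j)).1 htotal b (mem_univ b)
  simpa using this.symm

end Dilation

section Cross

open Finset

variable {n : ℕ}

/-- The members of the Lee ball of radius 1 around the origin. -/
def crossVec (n : ℕ) : Option (Fin n × ℤˣ) → Fin n → ℤ
  | none => 0
  | some (i, u) => Pi.single i (u : ℤ)

lemma crossVec_some (i : Fin n) (u : ℤˣ) : crossVec n (some (i, u)) = Pi.single i (u : ℤ) := rfl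

lemma crossVec_injective : Function.Injective (crossVec n) := by
  rintro (_ | ⟨i, u⟩) (_ | ⟨j, v⟩) h
  · rfl
  · have := congrFun h j
    simp only [crossVec, Pi.zero_apply, Pi.single_eq_same] at this
    exact absurd this.symm v.ne_zero
  · have := congrFun h i
    simp [crossVec] at this
  · have h1 := congrFun h i
    rcases eq_or_ne i j with rfl | hij
    · simp only [crossVec, Pi.single_eq_same, Units.val_inj] at h1
      rw [h1]
    · simp [crossVec, hij] at h1

lemma Int.abs_units_val (u : ℤˣ) : |(u : ℤ)| = 1 := by
  rcases Int.units_eq_one_or u with rfl | rfl <;> simp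

lemma Int.units_ne_neg_self (u : ℤˣ) : u ≠ -u := by
  rcases Int.units_eq_one_or u with rfl | rfl <;> decide

lemma exists_unit_of_abs_eq {z c : ℤ} (h : |z| = c) : ∃ u : ℤˣ, z = c * u := by
  rcases abs_choice z with h1 | h1
  · exact ⟨1, by simp; omega⟩
  · exact ⟨-1, by simp; omega⟩

lemma sum_abs_le_one_iff (y : Fin n → ℤ) : ∑ i, |y i| ≤ 1 ↔ ∃ k, y = crossVec n k := by
  constructor
  · intro h
    by_cases hy : y = 0
    · exact ⟨none, hy⟩
    obtain ⟨i, hi⟩ := Function.ne_iff.1 hy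
    have hi : 1 ≤ |y i| := Int.one_le_abs hi
    rw [← Finset.add_sum_erase _ _ (mem_univ i)] at h
    have hnn : 0 ≤ ∑ k ∈ univ.erase i, |y k| := Finset.sum_nonneg fun k _ => abs_nonneg _
    obtain ⟨u, hu⟩ := exists_unit_of_abs_eq (show |y i| = 1 by omega)
    have hz := (Finset.sum_eq_zero_iff_of_nonneg fun k _ => abs_nonneg (y k)).1
      (show ∑ k ∈ univ.erase i, |y k| = 0 by omega)
    refine ⟨some (i, u), funext fun k => ?_⟩
    rcases eq_or_ne k i with rfl | hk
    · simp [crossVec, hu]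
    · simpa [crossVec, hk] using hz k (by simp [hk])
  · rintro ⟨_ | ⟨i, u⟩, rfl⟩
    · simp [crossVec]
    · rw [Finset.sum_eq_single i]
      · simp [crossVec, Int.abs_units_val]
      · intro k _ hk
        simp [crossVec, hk]
      · simp

lemma PerfectLeeCode.existsUnique_sub_mem {T : Set (Fin n → ℤ)} (hT : PerfectLeeCode n T)
    (x : Fin n → ℤ) : ∃! k, x - crossVec n k ∈ T := by
  obtain ⟨t, ⟨ht, hd⟩, huniq⟩ := hT x
  obtain ⟨k, hk⟩ := (sum_abs_le_one_iff (x - t)).1 hd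
  refine ⟨k, by simpa [← hk] using ht, fun l hl => crossVec_injective ?_⟩
  have := huniq (x - crossVec n l)
    ⟨hl, (sum_abs_le_one_iff (x - (x - crossVec n l))).2 ⟨l, by simp⟩⟩
  rw [← hk, ← this]
  simp

open scoped Classical in
lemma sum_ite_mem_eq_one_iff {α ι : Type*} [Fintype ι] (T : Set α) (f : ι → α) :
    ∑ k, (if f k ∈ T then 1 else 0) = 1 ↔ ∃! k, f k ∈ T := by
  rw [Finset.sum_boole, Nat.cast_id, Finset.card_eq_one, Finset.singleton_iff_unique_mem]
  simp

/-- A perfect Lee code of radius 1 also tiles with the ball dilated by a prime not dividing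
`2 * n + 1`. -/
lemma PerfectLeeCode.existsUnique_sub_nsmul_mem {T : Set (Fin n → ℤ)} (hT : PerfectLeeCode n T)
    {p : ℕ} [Fact p.Prime] (hp : ¬p ∣ 2 * n + 1) (x : Fin n → ℤ) :
    ∃! k, x - p • crossVec n k ∈ T := by
  classical
  have hcard : Fintype.card (Option (Fin n × ℤˣ)) = 2 * n + 1 := by
    simp [mul_comm]
  rw [← sum_ite_mem_eq_one_iff]
  refine sum_sub_nsmul_eq_one (χ := fun y => if y ∈ T then 1 else 0) (by rwa [hcard])
    (fun y => ?_) x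
  exact (sum_ite_mem_eq_one_iff T _).2 (hT.existsUnique_sub_mem y)

lemma PerfectLeeCode.eq_of_nsmul_sub_mem {T : Set (Fin n → ℤ)} (hT : PerfectLeeCode n T)
    (h0 : 0 ∈ T) {p : ℕ} [Fact p.Prime] (hp : ¬p ∣ 2 * n + 1) {k l : Option (Fin n × ℤˣ)}
    (h : p • crossVec n k - p • crossVec n l ∈ T) : k = l :=
  (hT.existsUnique_sub_nsmul_mem hp (p • crossVec n k)).unique (by simpa using h0) h

lemma PerfectLeeCode.not_isType41 {T : Set (Fin n → ℤ)} (hT : PerfectLeeCode n T)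
    (h0 : 0 ∈ T) {W : Fin n → ℤ} (hW : W ∈ T) : ¬IsType41 W := by
  rintro ⟨i, hi, hz⟩
  obtain ⟨u, hu⟩ := exists_unit_of_abs_eq hi
  have h : W = 2 • crossVec n (some (i, u)) - 2 • crossVec n (some (i, -u)) := by
    funext k
    rcases eq_or_ne k i with rfl | hk
    · simp [crossVec, hu]; ring
    · simp [crossVec, hk, hz k hk]
  have := hT.eq_of_nsmul_sub_mem h0 (p := 2) (by omega) (h ▸ hW)
  simp only [Option.some.injEq, Prod.mk.injEq, true_and] at this
  exact Int.units_ne_neg_self u this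

lemma PerfectLeeCode.not_isType22 {T : Set (Fin n → ℤ)} (hT : PerfectLeeCode n T)
    (h0 : 0 ∈ T) {W : Fin n → ℤ} (hW : W ∈ T) : ¬IsType22 W := by
  rintro ⟨i, j, hij, hi, hj, hz⟩
  obtain ⟨u, hu⟩ := exists_unit_of_abs_eq hi
  obtain ⟨v, hv⟩ := exists_unit_of_abs_eq hj
  have h : W = 2 • crossVec n (some (i, u)) - 2 • crossVec n (some (j, -v)) := by
    funext k
    rcases eq_or_ne k i with rfl | hki
    · simp [crossVec, hu, hij]
    rcases eq_or_ne k j with rfl | hkj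
    · simp [crossVec, hv, hki]
    · simp [crossVec, hki, hkj, hz k hki hkj]
  have := hT.eq_of_nsmul_sub_mem h0 (p := 2) (by omega) (h ▸ hW)
  simp [hij] at this

lemma PerfectLeeCode.single_three_notMem {T : Set (Fin n → ℤ)} (hT : PerfectLeeCode n T)
    (h0 : 0 ∈ T) (hn : ¬3 ∣ 2 * n + 1) (i : Fin n) (u : ℤˣ) :
    Pi.single i (3 * u : ℤ) ∉ T := by
  intro h
  have h' : 3 • crossVec n (some (i, u)) - 3 • crossVec n none ∈ T := by
    convert h using 1
    simp [crossVec, ← Pi.single_smul]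
  simpa using hT.eq_of_nsmul_sub_mem h0 hn h'

lemma PerfectLeeCode.single_two_notMem {T : Set (Fin n → ℤ)} (hT : PerfectLeeCode n T)
    (h0 : 0 ∈ T) (i : Fin n) (u : ℤˣ) : Pi.single i (2 * u : ℤ) ∉ T := by
  intro h
  have := (hT.existsUnique_sub_mem (crossVec n (some (i, u)))).unique
    (y₁ := some (i, u)) (y₂ := some (i, -u)) (by simpa using h0) (by
      convert h using 1
      simp [crossVec, ← Pi.single_add, two_mul, sub_eq_add_neg, ← Pi.single_neg])
  simp only [Option.some.injEq, Prod.mk.injEq, true_and] at this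
  exact Int.units_ne_neg_self u this

/-- If `3 ∤ 2 * n + 1`, every word `±3eᵢ` is at distance 1 from a codeword of type [3^1,1^1]. -/
lemma PerfectLeeCode.exists_single_three_sub_mem {T : Set (Fin n → ℤ)} (hT : PerfectLeeCode n T)
    (h0 : 0 ∈ T) (hn : ¬3 ∣ 2 * n + 1) (i : Fin n) (u : ℤˣ) :
    ∃ j v, j ≠ i ∧ Pi.single i (3 * u : ℤ) - crossVec n (some (j, v)) ∈ T := by
  obtain ⟨k, hk, -⟩ := hT.existsUnique_sub_mem (Pi.single i (3 * u : ℤ))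
  rcases k with _ | ⟨j, v⟩
  · exact absurd (by simpa [crossVec] using hk) (hT.single_three_notMem h0 hn i u)
  refine ⟨j, v, ?_, hk⟩
  rintro rfl
  simp only [crossVec_some, ← Pi.single_sub] at hk
  rcases Int.units_eq_one_or u with rfl | rfl <;> rcases Int.units_eq_one_or v with rfl | rfl
  · exact hT.single_two_notMem h0 j 1 (by simpa using hk)
  · exact hT.not_isType41 h0 hk ⟨j, by simp, fun k hk => by simp [hk]⟩
  · exact hT.not_isType41 h0 hk ⟨j, by simp, fun k hk => by simp [hk]⟩
  · exact hT.single_two_notMem h0 j (-1) (by simpa using hk)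

lemma PerfectLeeCode.ncard_isType3111 {T : Set (Fin n → ℤ)} (hT : PerfectLeeCode n T)
    (h0 : 0 ∈ T) (hn : ¬3 ∣ 2 * n + 1) : {W ∈ T | IsType3111 W}.ncard = 2 * n := by
  choose j v hji hmem using hT.exists_single_three_sub_mem h0 hn
  let f : Fin n × ℤˣ → Fin n → ℤ := fun q =>
    Pi.single q.1 (3 * q.2 : ℤ) - crossVec n (some (j q.1 q.2, v q.1 q.2))
  have hf_self (q : Fin n × ℤˣ) : f q q.1 = 3 * q.2 := by
    simp [f, crossVec, (hji q.1 q.2).symm]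
  have hf_le (q : Fin n × ℤˣ) (k : Fin n) (hk : k ≠ q.1) : |f q k| ≤ 1 := by
    rcases eq_or_ne k (j q.1 q.2) with h | h
    · simp [f, crossVec, h, hji, Int.abs_units_val]
    · simp [f, crossVec, hk, h]
  have hf_inj : Function.Injective f := by
    rintro ⟨i, u⟩ ⟨i', u'⟩ h
    have h1 := hf_self (i, u)
    rw [h] at h1
    rcases eq_or_ne i i' with rfl | hne
    · rw [hf_self (i, u')] at h1
      have : u = u' := Units.ext (by simpa using h1.symm)
      rw [this]
    · have h2 := hf_le (i', u') i hne
      simp [h1, abs_mul, Int.abs_units_val] at h2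
  have hrange : {W ∈ T | IsType3111 W} = Set.range f := by
    ext W
    constructor
    · rintro ⟨hW, i, l, hil, hi, hl, hz⟩
      obtain ⟨u, hu⟩ := exists_unit_of_abs_eq hi
      obtain ⟨w, hw⟩ := exists_unit_of_abs_eq hl
      have hWeq : W = Pi.single i (3 * u : ℤ) - crossVec n (some (l, -w)) := by
        funext k
        rcases eq_or_ne k i with rfl | hki
        · simp [crossVec, hu, hil]
        rcases eq_or_ne k l with rfl | hkl
        · simp [crossVec, hw, hki]
        · simp [crossVec, hki, hkl, hz k hki hkl]
      have := (hT.existsUnique_sub_mem (Pi.single i (3 * u : ℤ))).unique (hWeq ▸ hW) (hmem i u)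
      exact ⟨(i, u), by rw [hWeq, this]⟩
    · rintro ⟨⟨i, u⟩, rfl⟩
      refine ⟨hmem i u, i, j i u, (hji i u).symm, ?_, ?_, fun k hki hkj => ?_⟩
      · simp [hf_self (i, u), abs_mul, Int.abs_units_val]
      · simp [f, crossVec, hji, Int.abs_units_val]
      · simp [f, crossVec, hki, hkj]
  rw [hrange, ← Set.image_univ, Set.ncard_image_of_injective _ hf_inj, Set.ncard_univ,
    Nat.card_eq_fintype_card]
  simp [mul_comm]

end Cross

/-- For `n ≡ 2 (mod 3)`: no codewords of types [4^1] or [2^2], and exactly `2n`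
codewords of type [3^1,1^1]. -/
theorem counts_41_22_3111 (n : ℕ) (hn : n % 3 = 2) (T : Set (Fin n → ℤ))
    (hT : PerfectLeeCode n T) (h0 : 0 ∈ T) :
    (∀ W ∈ T, ¬IsType41 W) ∧ (∀ W ∈ T, ¬IsType22 W) ∧
    {W ∈ T | IsType3111 W}.ncard = 2 * n := by
  exact ⟨fun W hW => hT.not_isType41 h0 hW, fun W hW => hT.not_isType22 h0 hW,
    hT.ncard_isType3111 h0 (by omega)⟩
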